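/- The density f(y) = ∫_{−∞}^{∞} φ(y/√|z|) (1/√|z|) φ(z) dz of the limit law of the normalized garbage term attains its maximal value at y = 0, and f(0) = (1/√(2π)) ∫_{−∞}^{∞} |z|^{−1/2} φ(z) dz = Γ(1/4)/(2^{3/4} π), where Γ is the Euler gamma function. -/

import Mathlib

open MeasureTheory Real Filter
open scoped ENNReal Topology

namespace Stmt5

/-- The standard normal density `φ(z) = (2π)^{-1/2} e^{-z²/2}`. -/
noncomputable def stdGaussPDF (z : ℝ) : ℝ :=
  Real.exp (-z ^ 2 / 2) / Real.sqrt (2 * Real.pi)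

/-- The density of the limit law of the normalized garbage term:
`f(y) = ∫ φ(y/√|z|) (1/√|z|) φ(z) dz`. -/
noncomputable def limitPDF (y : ℝ) : ℝ :=
  ∫ z : ℝ, stdGaussPDF (y / Real.sqrt |z|) * (1 / Real.sqrt |z|) * stdGaussPDF z

theorem stdGaussPDF_nonneg (z : ℝ) : 0 ≤ stdGaussPDF z := by
  unfold stdGaussPDF
  positivity

theorem stdGaussPDF_le_zero (z : ℝ) : stdGaussPDF z ≤ stdGaussPDF 0 := by
  unfold stdGaussPDF
  refine div_le_div_of_nonneg_right (Real.exp_le_exp.2 ?_) (Real.sqrt_nonneg _)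
  nlinarith [sq_nonneg z]

theorem stdGaussPDF_zero : stdGaussPDF 0 = 1 / Real.sqrt (2 * Real.pi) := by
  simp [stdGaussPDF]

theorem integral_one_div_sqrt_abs_mul_stdGaussPDF :
    ∫ z : ℝ, (1 / Real.sqrt |z|) * stdGaussPDF z
      = 2 ^ ((1 : ℝ) / 4) * Real.Gamma (1 / 4) / Real.sqrt (2 * Real.pi) := by
  have h_abs : ∀ z : ℝ, (1 / Real.sqrt |z|) * stdGaussPDF z
      = (fun x : ℝ => (1 / Real.sqrt x) * stdGaussPDF x) |z| := by
    intro z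
    simp [stdGaussPDF]
  have h_rpow : ∀ x ∈ Set.Ioi (0 : ℝ), (1 / Real.sqrt x) * stdGaussPDF x
      = x ^ (-(1 / 2) : ℝ) * Real.exp (-(1 / 2) * x ^ (2 : ℝ)) * (Real.sqrt (2 * Real.pi))⁻¹ := by
    intro x hx
    rw [Real.rpow_neg (le_of_lt hx), ← Real.sqrt_eq_rpow, Real.rpow_two, stdGaussPDF,
      show -x ^ 2 / 2 = -(1 / 2) * x ^ 2 by ring]
    ring
  simp_rw [h_abs]
  rw [integral_comp_abs (f := fun x : ℝ => (1 / Real.sqrt x) * stdGaussPDF x),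
    setIntegral_congr_fun measurableSet_Ioi h_rpow, integral_mul_const,
    integral_rpow_mul_exp_neg_mul_rpow (by norm_num) (by norm_num) (by norm_num)]
  have h_half : ((1 : ℝ) / 2) ^ (-(-(1 / 2) + 1) / 2 : ℝ) = 2 ^ ((1 : ℝ) / 4) := by
    rw [one_div, Real.inv_rpow (by norm_num), ← Real.rpow_neg (by norm_num)]
    norm_num
  rw [h_half, show ((-(1 / 2) + 1) / 2 : ℝ) = 1 / 4 by norm_num]
  ring

theorem limitPDF_zero : limitPDF 0 = (1 / Real.sqrt (2 * Real.pi))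
    * ∫ z : ℝ, (1 / Real.sqrt |z|) * stdGaussPDF z := by
  simp only [limitPDF, zero_div, stdGaussPDF_zero, mul_assoc, integral_const_mul]

theorem limitPDF_zero_eq_Gamma :
    limitPDF 0 = Real.Gamma (1 / 4) / (2 ^ ((3 : ℝ) / 4) * Real.pi) := by
  have h_sq : Real.sqrt (2 * Real.pi) * Real.sqrt (2 * Real.pi) = 2 * Real.pi :=
    Real.mul_self_sqrt (by positivity)
  have h_two : (2 : ℝ) ^ ((1 : ℝ) / 4) * 2 ^ ((3 : ℝ) / 4) = 2 := by
    rw [← Real.rpow_add (by norm_num)]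
    norm_num
  rw [limitPDF_zero, integral_one_div_sqrt_abs_mul_stdGaussPDF, div_mul_div_comm, h_sq,
    div_eq_div_iff (by positivity) (by positivity)]
  linear_combination (Real.Gamma (1 / 4) * Real.pi) * h_two

theorem limitPDF_le_zero (y : ℝ) : limitPDF y ≤ limitPDF 0 := by
  have h_pos : 0 < limitPDF 0 := by
    have := Real.Gamma_pos_of_pos (show (0 : ℝ) < 1 / 4 by norm_num)
    rw [limitPDF_zero_eq_Gamma]
    positivity
  refine integral_mono_of_nonneg (.of_forall fun z => ?_)
    (Integrable.of_integral_ne_zero h_pos.ne') (.of_forall fun z => ?_)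
  · have h_left := stdGaussPDF_nonneg (y / Real.sqrt |z|)
    have h_right := stdGaussPDF_nonneg z
    simp only [Pi.zero_apply]
    positivity
  · have h_right := stdGaussPDF_nonneg z
    simp only [zero_div]
    gcongr
    exact stdGaussPDF_le_zero _

/-- The density `f` attains its maximal value at `y = 0`, and
`f(0) = (1/√(2π)) ∫ |z|^{-1/2} φ(z) dz = Γ(1/4)/(2^{3/4} π)`. -/
theorem limitPDF_max_at_zero :
    (∀ y : ℝ, limitPDF y ≤ limitPDF 0) ∧
    limitPDF 0 = (1 / Real.sqrt (2 * Real.pi))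
      * ∫ z : ℝ, (1 / Real.sqrt |z|) * stdGaussPDF z ∧
    limitPDF 0 = Real.Gamma (1 / 4) / (2 ^ ((3 : ℝ) / 4) * Real.pi) := by
  exact ⟨limitPDF_le_zero, limitPDF_zero, limitPDF_zero_eq_Gamma⟩

end Stmt5
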